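/- Let k be a field and let D be the derived category of the abelian category of k-vector spaces (Mathlib's DerivedCategory of ModuleCat k). Let A and B be classes of objects of D, each stable under the shifts X ↦ X⟦1⟧ and X ↦ X⟦-1⟧, such that every morphism from an object of B to an object of A is zero. If A contains an object X with H^i(X) ≠ 0 for some integer i and B contains an object Y with H^j(Y) ≠ 0 for some integer j, then a contradiction follows. In other words, in any semiorthogonal decomposition of the derived category of k-vector spaces, one of the two components consists entirely of zero objects (the category D^b(k) is indecomposable). -/

import Mathlib

open CategoryTheory Limits Pretriangulated

namespace ModuleCat

universe v u

variable {k : Type u} [Field k]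

lemma exists_section_of_epi {V W : ModuleCat.{v} k} (f : V ⟶ W) [Epi f] :
    ∃ s : W ⟶ V, s ≫ f = 𝟙 W := by
  obtain ⟨s, hs⟩ := f.hom.exists_rightInverse_of_surjective
    (LinearMap.range_eq_top.2 ((ModuleCat.epi_iff_surjective f).1 inferInstance))
  exact ⟨ofHom s, hom_ext hs⟩

lemma exists_retraction_of_mono {V W : ModuleCat.{v} k} (f : V ⟶ W) [Mono f] :
    ∃ r : W ⟶ V, f ≫ r = 𝟙 V := by
  obtain ⟨r, hr⟩ := f.hom.exists_leftInverse_of_injective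
    (LinearMap.ker_eq_bot.2 ((ModuleCat.mono_iff_injective f).1 inferInstance))
  exact ⟨ofHom r, hom_ext hr⟩

lemma exists_hom_ne_zero {V W : ModuleCat.{v} k} (hV : ¬ IsZero V) (hW : ¬ IsZero W) :
    ∃ g : V ⟶ W, g ≠ 0 := by
  rw [isZero_iff_subsingleton, not_subsingleton_iff_nontrivial] at hV hW
  obtain ⟨x, hx⟩ := exists_ne (0 : V)
  obtain ⟨y, hy⟩ := exists_ne (0 : W)
  obtain ⟨l, hl⟩ : ∃ l : Module.Dual k V, l x ≠ 0 := by
    by_contra! h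
    exact hx ((Module.forall_dual_apply_eq_zero_iff k x).1 h)
  refine ⟨ofHom (l.smulRight y), fun h ↦ smul_ne_zero hl hy ?_⟩
  exact LinearMap.congr_fun (congrArg Hom.hom h) x

/-- Over a field, every morphism between homology objects is induced by a morphism of complexes. -/
lemma exists_homologyMap_eq {K L : CochainComplex (ModuleCat.{v} k) ℤ} (n : ℤ)
    (g : L.homology n ⟶ K.homology n) :
    ∃ φ : L ⟶ K, HomologicalComplex.homologyMap φ n = g := by
  obtain ⟨s, hs⟩ := exists_section_of_epi (K.homologyπ n)
  obtain ⟨r, hr⟩ := exists_retraction_of_mono (L.homologyι n)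
  let φ : L ⟶ K :=
    HomologicalComplex.mkHomToSingle (L.pOpcycles n ≫ r) (by simp) ≫
      HomologicalComplex.mkHomFromSingle (g ≫ s ≫ K.iCycles n) (by simp)
  have hφ : φ.f n = L.pOpcycles n ≫ r ≫ g ≫ s ≫ K.iCycles n := by simp [φ]
  have hc : HomologicalComplex.cyclesMap φ n = L.homologyπ n ≫ g ≫ s := by
    rw [← cancel_mono (K.iCycles n), HomologicalComplex.cyclesMap_i, hφ,
      ← HomologicalComplex.homology_π_ι_assoc, reassoc_of% hr]
    simp
  refine ⟨φ, ?_⟩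
  rw [← cancel_epi (L.homologyπ n), HomologicalComplex.homologyπ_naturality, hc]
  simp [hs]

end ModuleCat

namespace DerivedCategory

universe w v u

lemma exists_hom_ne_zero_of_homology {k : Type u} [Field k]
    [HasDerivedCategory.{w} (ModuleCat.{v} k)]
    {X Y : DerivedCategory (ModuleCat.{v} k)} {n : ℤ}
    (hY : ¬ IsZero ((homologyFunctor (ModuleCat k) n).obj Y))
    (hX : ¬ IsZero ((homologyFunctor (ModuleCat k) n).obj X)) :
    ∃ f : Y ⟶ X, f ≠ 0 := by
  let H := homologyFunctor (ModuleCat.{v} k) n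
  let eX := H.mapIso (Q.objObjPreimageIso X).symm ≪≫
    (homologyFunctorFactors (ModuleCat.{v} k) n).app (Q.objPreimage X)
  let eY := H.mapIso (Q.objObjPreimageIso Y).symm ≪≫
    (homologyFunctorFactors (ModuleCat.{v} k) n).app (Q.objPreimage Y)
  obtain ⟨g, hg⟩ := ModuleCat.exists_hom_ne_zero
    (fun h ↦ hY (h.of_iso eY)) (fun h ↦ hX (h.of_iso eX))
  obtain ⟨φ, rfl⟩ := ModuleCat.exists_homologyMap_eq n g
  refine ⟨(Q.objObjPreimageIso Y).inv ≫ Q.map φ ≫ (Q.objObjPreimageIso X).hom, fun h ↦ hg ?_⟩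
  have hQ : Q.map φ = 0 := by simpa using h
  have := homologyFunctorFactors_hom_naturality φ n
  rw [hQ, Functor.map_zero, zero_comp] at this
  refine (cancel_epi ((homologyFunctorFactors (ModuleCat.{v} k) n).hom.app _)).1 ?_
  exact this.symm.trans comp_zero.symm

lemma exists_mem_not_isZero_homology {C : Type u} [Category.{v} C] [Abelian C]
    [HasDerivedCategory.{w} C] {A : Set (DerivedCategory C)}
    (h₁ : ∀ X ∈ A, X⟦(1 : ℤ)⟧ ∈ A) (h₂ : ∀ X ∈ A, X⟦(-1 : ℤ)⟧ ∈ A)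
    {X : DerivedCategory C} (hX : X ∈ A) {i : ℤ}
    (hXi : ¬ IsZero ((homologyFunctor C i).obj X)) (n : ℤ) :
    ∃ X' ∈ A, ¬ IsZero ((homologyFunctor C n).obj X') := by
  induction n using Int.inductionOn' (b := i) with
  | zero => exact ⟨X, hX, hXi⟩
  | succ m _ ih =>
    obtain ⟨Z, hZ, hZm⟩ := ih
    exact ⟨_, h₂ Z hZ, fun h ↦ hZm (h.of_iso
      (((homologyFunctor C 0).shiftIso (-1) (m + 1) m (by lia)).app Z).symm)⟩
  | pred m _ ih =>
    obtain ⟨Z, hZ, hZm⟩ := ih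
    exact ⟨_, h₁ Z hZ, fun h ↦ hZm (h.of_iso
      (((homologyFunctor C 0).shiftIso 1 (m - 1) m (by lia)).app Z).symm)⟩

end DerivedCategory

/-- the bounded derived category of `k`-vector spaces is indecomposable: in any
semiorthogonal pair `(A, B)` of shift-stable classes of objects of the derived category of
`ModuleCat k`, it is impossible that `A` contains an object with nonzero homology and `B`
contains an object with nonzero homology. -/
theorem statement6 {k : Type*} [Field k] [HasDerivedCategory (ModuleCat k)]
    (A B : Set (DerivedCategory (ModuleCat k)))
    (hA1 : ∀ X ∈ A, (X⟦(1 : ℤ)⟧) ∈ A) (hA1' : ∀ X ∈ A, (X⟦(-1 : ℤ)⟧) ∈ A)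
    (hB1 : ∀ X ∈ B, (X⟦(1 : ℤ)⟧) ∈ B) (hB1' : ∀ X ∈ B, (X⟦(-1 : ℤ)⟧) ∈ B)
    (hBA : ∀ Y ∈ B, ∀ X ∈ A, ∀ f : Y ⟶ X, f = 0)
    (X : DerivedCategory (ModuleCat k)) (hX : X ∈ A)
    (i : ℤ) (hXi : ¬ IsZero ((DerivedCategory.homologyFunctor (ModuleCat k) i).obj X))
    (Y : DerivedCategory (ModuleCat k)) (hY : Y ∈ B)
    (j : ℤ) (hYj : ¬ IsZero ((DerivedCategory.homologyFunctor (ModuleCat k) j).obj Y)) :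
    False := by
  obtain ⟨X', hX', hXj⟩ := DerivedCategory.exists_mem_not_isZero_homology hA1 hA1' hX hXi j
  obtain ⟨f, hf⟩ := DerivedCategory.exists_hom_ne_zero_of_homology hYj hXj
  exact hf (hBA Y hY X' hX' f)
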